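/- Let α be a finite type, let z_l, z_s : α → ℝ, and let λ ∈ ℝ. Then for every y, softmax(λ • z_l + (1−λ) • z_s) y = (softmax(z_l) y)^λ * (softmax(z_s) y)^(1−λ) / (∑ y', (softmax(z_l) y')^λ * (softmax(z_s) y')^(1−λ)); that is, the softmax of the λ-weighted logits ensemble is the normalized λ-weighted geometric mean of the two softmax distributions. -/

import Mathlib

open Real Finset

noncomputable def softmax {α : Type*} [Fintype α] (z : α → ℝ) (y : α) : ℝ :=
  Real.exp (z y) / ∑ y', Real.exp (z y')

theorem sum_exp_pos {α : Type*} [Fintype α] [Nonempty α] (z : α → ℝ) :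
    0 < ∑ y, Real.exp (z y) :=
  Finset.sum_pos (fun _ _ => Real.exp_pos _) Finset.univ_nonempty

theorem softmax_rpow {α : Type*} [Fintype α] (z : α → ℝ) (t : ℝ) (y : α) :
    softmax z y ^ t = Real.exp (t * z y) / (∑ y', Real.exp (z y')) ^ t := by
  rw [softmax, Real.div_rpow (Real.exp_pos _).le
    (Finset.sum_nonneg fun _ _ => (Real.exp_pos _).le), ← Real.exp_mul, mul_comm]

theorem softmax_weighted_logits_eq_weighted_geom_mean {α : Type*} [Fintype α]
    (zl zs : α → ℝ) (lam : ℝ) :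
    ∀ y, softmax (lam • zl + (1 - lam) • zs) y =
      (softmax zl y) ^ lam * (softmax zs y) ^ (1 - lam) /
        (∑ y', (softmax zl y') ^ lam * (softmax zs y') ^ (1 - lam)) := by
  intro y
  have : Nonempty α := ⟨y⟩
  have hl := Real.rpow_pos_of_pos (sum_exp_pos zl) lam
  have hs := Real.rpow_pos_of_pos (sum_exp_pos zs) (1 - lam)
  simp only [softmax_rpow, div_mul_div_comm, ← Real.exp_add, ← Finset.sum_div]
  rw [div_div_div_cancel_right₀ (mul_pos hl hs).ne']
  simp only [softmax, Pi.add_apply, Pi.smul_apply, smul_eq_mul]
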